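/- arXiv:2003.10368 — 5 statements merged into one kernel-verified Lean document; each statement's English description precedes it below -/
import Mathlib

section
/- Let Γ be a group and ξ : Γ → GL₂(ℝ) a group homomorphism such that ξ(γ)·e₁ = e₁ for every γ ∈ Γ, and suppose the homomorphism ρ : Γ → ℝ, ρ(γ) := det(ξ(γ)), is nontrivial (i.e. ρ(γ₀) ≠ 1 for some γ₀). Then ξ is decomposable if and only if the commutator subgroup [Γ,Γ] is contained in the kernel of ξ (equivalently, ξ(⁅a,b⁆) = 1 for all a, b ∈ Γ). -/
/-- The commutator subgroup lies in the kernel of `f` exactly when the image of `f` commutes. -/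
theorem commutator_le_ker_iff {G H : Type*} [Group G] [Group H] (f : G →* H) :
    commutator G ≤ f.ker ↔ ∀ a b : G, f a * f b = f b * f a := by
  simp only [commutator_def, Subgroup.commutator_le, Subgroup.mem_top, forall_const,
    MonoidHom.mem_ker, map_commutatorElement, commutatorElement_eq_one_iff_mul_comm]

/-- A `2 × 2` matrix fixing the first basis vector has first column `(1, 0)`. -/
theorem eq_of_mulVec_first_basis {R : Type*} [CommRing R] {M : Matrix (Fin 2) (Fin 2) R}
    (h : M.mulVec ![1, 0] = ![1, 0]) : M = !![1, M 0 1; 0, M 1 1] := by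
  have h0 : M 0 0 = 1 := by simpa [Matrix.mulVec, dotProduct] using congrFun h 0
  have h1 : M 1 0 = 0 := by simpa [Matrix.mulVec, dotProduct] using congrFun h 1
  rw [← h0, ← h1]
  exact Matrix.eta_fin_two M

/-- Two matrices with first column `(1, 0)` commute iff their off-diagonal entries are
proportional to their lower right entries minus one. -/
theorem mul_comm_iff_of_first_column {R : Type*} [CommRing R] (b d b' d' : R) :
    !![1, b; 0, d] * !![1, b'; 0, d'] = !![1, b'; 0, d'] * !![1, b; 0, d] ↔
      b * (d' - 1) = b' * (d - 1) := by
  rw [Matrix.mul_fin_two, Matrix.mul_fin_two]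
  constructor
  · intro h
    have h01 := congrFun (congrFun h 0) 1
    simp at h01
    linear_combination h01
  · intro h
    ext i j
    fin_cases i <;> fin_cases j <;> simp
    · linear_combination h
    · ring


/-- A representation `ξ : Γ → GL₂(ℝ)` fixing the vector `e₁ = (1,0)ᵀ`, whose determinant
character `ρ = det ∘ ξ` is nontrivial, is decomposable (i.e. some line not spanned by `e₁`
is invariant under all `ξ γ`) if and only if the commutator subgroup `[Γ,Γ]` is contained
in the kernel of `ξ`. -/
theorem stmt0 (Γ : Type*) [Group Γ] (ξ : Γ →* GL (Fin 2) ℝ)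
    (hfix : ∀ γ : Γ, (ξ γ : Matrix (Fin 2) (Fin 2) ℝ).mulVec ![1, 0] = ![1, 0])
    (hρ : ∃ γ₀ : Γ, (ξ γ₀ : Matrix (Fin 2) (Fin 2) ℝ).det ≠ 1) :
    (∃ v : Fin 2 → ℝ, (¬ ∃ t : ℝ, v = t • ![1, 0]) ∧
        ∀ γ : Γ, ∃ t : ℝ, (ξ γ : Matrix (Fin 2) (Fin 2) ℝ).mulVec v = t • v) ↔
      commutator Γ ≤ ξ.ker := by
  have hcomm : commutator Γ ≤ ξ.ker ↔ ∀ a b : Γ,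
      (ξ a).val 0 1 * ((ξ b).val 1 1 - 1) = (ξ b).val 0 1 * ((ξ a).val 1 1 - 1) := by
    rw [commutator_le_ker_iff]
    refine forall₂_congr fun a b => ?_
    rw [← mul_comm_iff_of_first_column, ← eq_of_mulVec_first_basis (hfix a),
      ← eq_of_mulVec_first_basis (hfix b), ← Units.val_mul, ← Units.val_mul, Units.ext_iff]
  rw [hcomm]
  constructor
  · rintro ⟨v, hv, hinv⟩ a b
    have hv1 : v 1 ≠ 0 := fun h => hv ⟨v 0, by ext i; fin_cases i <;> simp [h]⟩
    have key (γ : Γ) : (ξ γ).val 0 1 * v 1 = ((ξ γ).val 1 1 - 1) * v 0 := by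
      obtain ⟨t, ht⟩ := hinv γ
      rw [eq_of_mulVec_first_basis (hfix γ)] at ht
      have h0 := congrFun ht 0
      have h1 := congrFun ht 1
      simp [Matrix.mulVec, dotProduct] at h0 h1
      have htd : (ξ γ).val 1 1 = t := h1.resolve_right hv1
      rw [htd]
      linear_combination h0
    apply mul_right_cancel₀ hv1
    linear_combination ((ξ b).val 1 1 - 1) * key a - ((ξ a).val 1 1 - 1) * key b
  · intro h
    obtain ⟨γ₀, hγ₀⟩ := hρ
    rw [eq_of_mulVec_first_basis (hfix γ₀), Matrix.det_fin_two_of] at hγ₀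
    refine ⟨![(ξ γ₀).val 0 1, (ξ γ₀).val 1 1 - 1], ?_, fun γ => ⟨(ξ γ).val 1 1, ?_⟩⟩
    · rintro ⟨t, ht⟩
      have h1 := congrFun ht 1
      simp at h1
      apply hγ₀
      linear_combination h1
    · rw [eq_of_mulVec_first_basis (hfix γ)]
      ext i
      fin_cases i <;> simp [Matrix.mulVec, dotProduct]
      linear_combination h γ γ₀
end

section
/- Let Γ be a nilpotent group and ξ : Γ → GL₂(ℝ) a group homomorphism such that ξ(γ)·e₁ = e₁ for every γ ∈ Γ. If the homomorphism γ ↦ det(ξ(γ)) is nontrivial, then the commutator subgroup [Γ,Γ] is contained in the kernel of ξ; in particular ξ is decomposable. -/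
open scoped commutatorElement

open Matrix in
/-- A matrix fixing `(1,0)ᵀ` has first column `(1,0)ᵀ`. -/
theorem Matrix.eq_of_mulVec_e₁ {A : Matrix (Fin 2) (Fin 2) ℝ} (h : A *ᵥ ![1, 0] = ![1, 0]) :
    A = !![1, A 0 1; 0, A 1 1] := by
  have h0 := congrFun h 0
  have h1 := congrFun h 1
  simp [mulVec, dotProduct, Fin.sum_univ_two] at h0 h1
  ext i j
  fin_cases i <;> fin_cases j <;> simp [h0, h1]

/-- A function on a nilpotent group which vanishes at `1`, and whose vanishing at the commutator
`⁅g, g₀⁆` forces its vanishing at `g`, is identically zero. -/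
theorem Group.IsNilpotent.eq_zero_of_commutator {G M : Type*} [Group G] [Group.IsNilpotent G]
    [Zero M] (u : G → M) (g₀ : G) (h_one : u 1 = 0) (h : ∀ g, u ⁅g, g₀⁆ = 0 → u g = 0) (g : G) :
    u g = 0 := by
  by_contra hg
  have key : ∀ n : ℕ, ∃ k ∈ (⊤ : Subgroup G).lowerCentralSeries n, u k ≠ 0 := by
    intro n
    induction n with
    | zero => exact ⟨g, by simp, hg⟩
    | succ n ih =>
      obtain ⟨k, hk, huk⟩ := ih
      exact ⟨⁅k, g₀⁆, Subgroup.commutator_mem_commutator hk (Subgroup.mem_top g₀),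
        fun h' => huk (h k h')⟩
  obtain ⟨n, hn⟩ := Subgroup.nilpotent_iff_lowerCentralSeries.mp ‹Group.IsNilpotent G›
  obtain ⟨k, hk, huk⟩ := key n
  rw [hn, Subgroup.mem_bot] at hk
  exact huk (hk ▸ h_one)


/-- If `Γ` is a nilpotent group and `ξ : Γ → GL₂(ℝ)` is a representation fixing
`e₁ = (1,0)ᵀ` whose determinant character is nontrivial, then the commutator subgroup
`[Γ,Γ]` lies in the kernel of `ξ`; in particular `ξ` is decomposable. -/
theorem stmt1 (Γ : Type*) [Group Γ] [Group.IsNilpotent Γ] (ξ : Γ →* GL (Fin 2) ℝ)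
    (hfix : ∀ γ : Γ, (ξ γ : Matrix (Fin 2) (Fin 2) ℝ).mulVec ![1, 0] = ![1, 0])
    (hρ : ∃ γ₀ : Γ, (ξ γ₀ : Matrix (Fin 2) (Fin 2) ℝ).det ≠ 1) :
    commutator Γ ≤ ξ.ker ∧
      ∃ v : Fin 2 → ℝ, (¬ ∃ t : ℝ, v = t • ![1, 0]) ∧
        ∀ γ : Γ, ∃ t : ℝ, (ξ γ : Matrix (Fin 2) (Fin 2) ℝ).mulVec v = t • v := by
  obtain ⟨γ₀, hγ₀⟩ := hρ
  obtain ⟨b, d, hξ⟩ : ∃ b d : Γ → ℝ, ∀ γ, (ξ γ : Matrix (Fin 2) (Fin 2) ℝ) = !![1, b γ; 0, d γ] :=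
    ⟨fun γ => ξ γ 0 1, fun γ => ξ γ 1 1, fun γ => Matrix.eq_of_mulVec_e₁ (hfix γ)⟩
  have hmul (g h : Γ) : b (g * h) = b h + b g * d h ∧ d (g * h) = d g * d h := by
    have := hξ (g * h)
    rw [map_mul, Units.val_mul, hξ, hξ, Matrix.mul_fin_two] at this
    have h01 := congrFun₂ this 0 1
    have h11 := congrFun₂ this 1 1
    simp at h01 h11
    exact ⟨h01.symm, h11.symm⟩
  have hone : b 1 = 0 ∧ d 1 = 1 := by
    have := hξ 1
    rw [map_one, Units.val_one] at this
    have h01 := congrFun₂ this 0 1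
    have h11 := congrFun₂ this 1 1
    simp at h01 h11
    exact ⟨h01.symm, h11.symm⟩
  have hd₀ : d γ₀ - 1 ≠ 0 := by
    rw [hξ, Matrix.det_fin_two_of] at hγ₀
    simpa [sub_eq_zero] using hγ₀
  obtain ⟨x, hx⟩ : ∃ x : ℝ, b γ₀ = x * (d γ₀ - 1) := ⟨b γ₀ / (d γ₀ - 1), by field_simp⟩
  have hb (γ : Γ) : b γ - x * (d γ - 1) = 0 := by
    refine Group.IsNilpotent.eq_zero_of_commutator (fun γ => b γ - x * (d γ - 1)) γ₀
      (by simp [hone]) (fun g hg => ?_) γ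
    have hc : ⁅g, γ₀⁆ * (γ₀ * g) = g * γ₀ := by simp [commutatorElement_def, mul_assoc]
    have hcb := (hmul ⁅g, γ₀⁆ (γ₀ * g)).1
    have hcd := (hmul ⁅g, γ₀⁆ (γ₀ * g)).2
    rw [hc] at hcb hcd
    rw [(hmul g γ₀).1, (hmul γ₀ g).1, (hmul γ₀ g).2] at hcb
    rw [(hmul g γ₀).2, (hmul γ₀ g).2] at hcd
    refine (mul_eq_zero.mp ?_).resolve_right hd₀
    linear_combination hcb - x * hcd + d γ₀ * d g * hg - (1 - d g) * hx
  refine ⟨?_, ![x, 1], ?_, fun γ => ⟨d γ, ?_⟩⟩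
  · rw [commutator_def, Subgroup.commutator_le]
    intro g _ h _
    rw [MonoidHom.mem_ker, map_commutatorElement, commutatorElement_eq_one_iff_mul_comm,
      ← map_mul, ← map_mul]
    ext1
    rw [hξ, hξ, (hmul g h).1, (hmul g h).2, (hmul h g).1, (hmul h g).2, mul_comm (d h)]
    congr 4
    linear_combination (d h - 1) * hb g - (d g - 1) * hb h
  · rintro ⟨t, ht⟩
    simpa using congrFun ht 1
  · rw [hξ]
    ext i
    fin_cases i
    · simp [Matrix.mulVec, dotProduct, Fin.sum_univ_two]
      linear_combination hb γ
    · simp [Matrix.mulVec, dotProduct, Fin.sum_univ_two]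
end

section
/- Let Γ be a group generated by m elements a₁, …, a_m whose commutator subgroup G = [Γ,Γ] is generated by k elements b₁, …, b_k. Then the set of group homomorphisms ρ : Γ → (ℝ₊*, ×) (positive reals under multiplication) for which there exists a group homomorphism ξ : Γ → GL₂(ℝ) fixing e₁ with det(ξ(γ)) = ρ(γ) for all γ and with ξ nontrivial on [Γ,Γ] (i.e. ξ(b) ≠ 1 for some b ∈ [Γ,Γ]) is finite, of cardinality at most k^m. -/
open Module in
/-- The additive characters `G → ℝ` of a group generated by `k` elements form a real vector
space of dimension at most `k`. -/
theorem finite_and_finrank_additiveHom_le {G : Type*} [Group G] {k : ℕ} (b : Fin k → G)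
    (hb : Subgroup.closure (Set.range b) = ⊤) :
    Module.Finite ℝ (Additive G →+ ℝ) ∧ finrank ℝ (Additive G →+ ℝ) ≤ k := by
  let ev : (Additive G →+ ℝ) →ₗ[ℝ] (Fin k → ℝ) :=
    { toFun := fun f i => f (Additive.ofMul (b i))
      map_add' := fun _ _ => rfl
      map_smul' := fun _ _ => rfl }
  have hev : Function.Injective ev := by
    intro f g hfg
    have h : AddMonoidHom.toMultiplicativeRight f = AddMonoidHom.toMultiplicativeRight g := by
      refine MonoidHom.eq_of_eqOn_dense hb ?_
      rintro _ ⟨i, rfl⟩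
      exact congrArg Multiplicative.ofAdd (congrFun hfg i)
    exact AddMonoidHom.toMultiplicativeRight.injective h
  exact ⟨Module.Finite.of_injective ev hev,
    (LinearMap.finrank_le_finrank_of_injective hev).trans_eq (by simp)⟩

/-- The action of `γ` on the additive characters of a normal subgroup, by precomposition with
`c ↦ γ⁻¹ * c * γ`. -/
noncomputable def conjAdditiveHom {Γ : Type*} [Group Γ] (N : Subgroup Γ) [N.Normal] (γ : Γ) :
    Module.End ℝ (Additive N →+ ℝ) where
  toFun f := f.comp (MonoidHom.toAdditive (MulAut.conjNormal (H := N) γ⁻¹).toMonoidHom)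
  map_add' _ _ := rfl
  map_smul' _ _ := rfl

/-- A linear endomorphism of a finite-dimensional space has at most `finrank` eigenvalues. -/
theorem exists_finset_card_le_finrank_eigenvalues {K V : Type*} [Field K] [AddCommGroup V]
    [Module K V] [Module.Finite K V] (T : Module.End K V) :
    ∃ E : Finset K, E.card ≤ Module.finrank K V ∧ ∀ r, T.HasEigenvalue r → r ∈ E := by
  classical
  refine ⟨T.charpoly.roots.toFinset, ?_, fun r hr => ?_⟩
  · calc _ ≤ _ := Multiset.toFinset_card_le _
      _ ≤ _ := Polynomial.card_roots' _
      _ = _ := LinearMap.charpoly_natDegree T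
  · rw [Multiset.mem_toFinset, Polynomial.mem_roots (LinearMap.charpoly_monic T).ne_zero]
    exact Module.End.hasEigenvalue_iff_isRoot_charpoly T r |>.mp hr

/-- The determinant of a representation fixing `e₁` and nontrivial on the commutator subgroup is,
at each `γ`, an eigenvalue of the action of `γ` on the additive characters of that subgroup. -/
theorem hasEigenvalue_conjAdditiveHom {Γ : Type*} [Group Γ] (ρ : Γ →* ℝ)
    (ξ : Γ →* GL (Fin 2) ℝ)
    (hfix : ∀ γ : Γ, (ξ γ : Matrix (Fin 2) (Fin 2) ℝ).mulVec ![1, 0] = ![1, 0])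
    (hdet : ∀ γ : Γ, (ξ γ : Matrix (Fin 2) (Fin 2) ℝ).det = ρ γ)
    (hne : ∃ c ∈ commutator Γ, ξ c ≠ 1) (γ : Γ) :
    (conjAdditiveHom (commutator Γ) γ).HasEigenvalue (ρ γ) := by
  have h00 (g : Γ) : (ξ g : Matrix (Fin 2) (Fin 2) ℝ) 0 0 = 1 := by
    simpa [Matrix.mulVec, dotProduct, Fin.sum_univ_two] using congrFun (hfix g) 0
  have h10 (g : Γ) : (ξ g : Matrix (Fin 2) (Fin 2) ℝ) 1 0 = 0 := by
    simpa [Matrix.mulVec, dotProduct, Fin.sum_univ_two] using congrFun (hfix g) 1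
  have h11 (g : Γ) : (ξ g : Matrix (Fin 2) (Fin 2) ℝ) 1 1 = ρ g := by
    simpa [Matrix.det_fin_two, h00, h10] using hdet g
  have hmul (g h : Γ) : (ξ (g * h) : Matrix (Fin 2) (Fin 2) ℝ) 0 1 =
      (ξ h : Matrix (Fin 2) (Fin 2) ℝ) 0 1 + (ξ g : Matrix (Fin 2) (Fin 2) ℝ) 0 1 * ρ h := by
    simp [Matrix.mul_apply, Fin.sum_univ_two, h00, h11]
  have hone : (ξ 1 : Matrix (Fin 2) (Fin 2) ℝ) 0 1 = 0 := by simp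
  have hρ (c : Γ) (hc : c ∈ commutator Γ) : ρ c = 1 :=
    congrArg Units.val (Abelianization.commutator_subset_ker ρ.toHomUnits hc)
  let t : Additive (commutator Γ) →+ ℝ :=
    { toFun := fun c => (ξ (c.toMul : Γ) : Matrix (Fin 2) (Fin 2) ℝ) 0 1
      map_zero' := hone
      map_add' := fun c d => by
        rw [toMul_add, Subgroup.coe_mul, hmul, hρ _ d.toMul.2, mul_one, add_comm] }
  refine Module.End.hasEigenvalue_of_hasEigenvector (x := t)
    ⟨Module.End.mem_eigenspace_iff.mpr ?_, fun ht => ?_⟩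
  · refine AddMonoidHom.ext fun c => ?_
    change (ξ (MulAut.conjNormal γ⁻¹ c.toMul : commutator Γ) : Matrix (Fin 2) (Fin 2) ℝ) 0 1 =
      ρ γ * (ξ (c.toMul : Γ) : Matrix (Fin 2) (Fin 2) ℝ) 0 1
    have hinv := hmul γ⁻¹ γ
    rw [inv_mul_cancel, hone] at hinv
    rw [MulAut.conjNormal_apply, inv_inv, hmul, hmul, hρ _ c.toMul.2]
    linear_combination -hinv
  · obtain ⟨c, hc, hξ⟩ := hne
    refine hξ (Units.ext (Matrix.ext fun i j => ?_))
    have h01 : (ξ c : Matrix (Fin 2) (Fin 2) ℝ) 0 1 = 0 :=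
      DFunLike.congr_fun ht (Additive.ofMul ⟨c, hc⟩)
    fin_cases i <;> fin_cases j <;> simp [h00, h10, h11, h01, hρ c hc]

/-- If `Γ` is generated by `m` elements and its commutator subgroup is generated by `k`
elements, then the set of positive characters `ρ : Γ → (ℝ₊*, ×)` arising as the determinant
of some representation `ξ : Γ → GL₂(ℝ)` which fixes `e₁` and is nontrivial on `[Γ,Γ]`
is finite, with at most `k ^ m` elements. -/
theorem stmt2 (Γ : Type*) [Group Γ] (m k : ℕ)
    (a : Fin m → Γ) (ha : Subgroup.closure (Set.range a) = ⊤)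
    (b : Fin k → Γ) (hb : Subgroup.closure (Set.range b) = commutator Γ) :
    {ρ : Γ →* ℝ | (∀ γ : Γ, 0 < ρ γ) ∧
      ∃ ξ : Γ →* GL (Fin 2) ℝ,
        (∀ γ : Γ, (ξ γ : Matrix (Fin 2) (Fin 2) ℝ).mulVec ![1, 0] = ![1, 0]) ∧
        (∀ γ : Γ, (ξ γ : Matrix (Fin 2) (Fin 2) ℝ).det = ρ γ) ∧
        ∃ c ∈ commutator Γ, ξ c ≠ 1}.Finite ∧
    Nat.card {ρ : Γ →* ℝ | (∀ γ : Γ, 0 < ρ γ) ∧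
      ∃ ξ : Γ →* GL (Fin 2) ℝ,
        (∀ γ : Γ, (ξ γ : Matrix (Fin 2) (Fin 2) ℝ).mulVec ![1, 0] = ![1, 0]) ∧
        (∀ γ : Γ, (ξ γ : Matrix (Fin 2) (Fin 2) ℝ).det = ρ γ) ∧
        ∃ c ∈ commutator Γ, ξ c ≠ 1} ≤ k ^ m := by
  classical
  have hb' : Subgroup.closure (Set.range fun i =>
      (⟨b i, hb ▸ Subgroup.subset_closure ⟨i, rfl⟩⟩ : commutator Γ)) = ⊤ := by
    refine Subgroup.map_injective (commutator Γ).subtype_injective ?_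
    rw [MonoidHom.map_closure, ← Set.range_comp, ← MonoidHom.range_eq_map, Subgroup.range_subtype]
    exact hb
  obtain ⟨hfin, hrank⟩ := finite_and_finrank_additiveHom_le _ hb'
  choose E hcard hE using fun i =>
    exists_finset_card_le_finrank_eigenvalues (conjAdditiveHom (commutator Γ) (a i))
  let F : (Γ →* ℝ) → Fin m → ℝ := fun ρ i => ρ (a i)
  have hF : Function.Injective F := fun ρ σ h =>
    MonoidHom.eq_of_eqOn_dense ha (by rintro _ ⟨i, rfl⟩; exact congrFun h i)
  have hsub : {ρ : Γ →* ℝ | (∀ γ : Γ, 0 < ρ γ) ∧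
      ∃ ξ : Γ →* GL (Fin 2) ℝ,
        (∀ γ : Γ, (ξ γ : Matrix (Fin 2) (Fin 2) ℝ).mulVec ![1, 0] = ![1, 0]) ∧
        (∀ γ : Γ, (ξ γ : Matrix (Fin 2) (Fin 2) ℝ).det = ρ γ) ∧
        ∃ c ∈ commutator Γ, ξ c ≠ 1} ⊆ F ⁻¹' (Fintype.piFinset E : Set (Fin m → ℝ)) := by
    rintro ρ ⟨-, ξ, hfix, hdet, hne⟩
    exact Fintype.mem_piFinset.mpr fun i =>
      hE i _ (hasEigenvalue_conjAdditiveHom ρ ξ hfix hdet hne (a i))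
  have hpre := (Fintype.piFinset E).finite_toSet.preimage hF.injOn
  refine ⟨hpre.subset hsub, ?_⟩
  calc _ ≤ _ := Set.ncard_le_ncard hsub hpre
    _ ≤ (Fintype.piFinset E : Set (Fin m → ℝ)).ncard :=
      Set.ncard_le_ncard_of_injOn F (fun _ h => h) hF.injOn (Finset.finite_toSet _)
    _ = ∏ i, (E i).card := by rw [Set.ncard_coe_finset, Fintype.card_piFinset]
    _ ≤ ∏ _i : Fin m, k := Finset.prod_le_prod' fun i _ => (hcard i).trans hrank
    _ = k ^ m := by simp
end

section
/- Let Γ be a group, ξ : Γ → GL₂(ℝ) a group homomorphism fixing e₁, and set ρ(γ) := det(ξ(γ)). Let a ∈ Γ, let k ≥ 1, and let b₁, …, b_k be elements of the commutator subgroup [Γ,Γ] such that ξ(b_{i₀}) ≠ 1 for some i₀. Suppose there are integers n_{iℓ} (1 ≤ i, ℓ ≤ k) such that a^{-1} b_i a = ∏_{ℓ=1}^{k} b_ℓ^{n_{iℓ}} for every i. Then ρ(a) is an eigenvalue of the k×k integer matrix N = (n_{iℓ}) viewed as a real matrix. (Indeed, since each b_i lies in [Γ,Γ] one has ξ(b_i)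 = [[1, x_i],[0,1]] for some x_i ∈ ℝ, the vector x = (x₁,…,x_k) is nonzero, and N·x = ρ(a)·x.) -/
open Matrix.GeneralLinearGroup in
/-- A matrix of determinant one fixing `e₁` is upper unitriangular. -/
lemma eq_upperRightHom_of_mulVec_of_det {R : Type*} [CommRing R] (g : GL (Fin 2) R)
    (hg : (g : Matrix (Fin 2) (Fin 2) R).mulVec ![1, 0] = ![1, 0])
    (hdet : (g : Matrix (Fin 2) (Fin 2) R).det = 1) : g = upperRightHom (g.val 0 1) := by
  have h0 : g.val 0 0 = 1 := by simpa [Matrix.mulVec, dotProduct] using congrFun hg 0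
  have h1 : g.val 1 0 = 0 := by simpa [Matrix.mulVec, dotProduct] using congrFun hg 1
  have h2 : g.val 1 1 = 1 := by simpa [Matrix.det_fin_two, h0, h1] using hdet
  ext i j
  fin_cases i <;> fin_cases j <;> simp [h0, h1, h2]

open Matrix.GeneralLinearGroup in
/-- A matrix fixing `e₁` conjugates upper unitriangular matrices by scaling by its determinant. -/
lemma upperRightHom_mul_eq_mul_upperRightHom {R : Type*} [CommRing R] (g : GL (Fin 2) R)
    (hg : (g : Matrix (Fin 2) (Fin 2) R).mulVec ![1, 0] = ![1, 0]) (x : R) :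
    upperRightHom x * g =
      g * upperRightHom ((g : Matrix (Fin 2) (Fin 2) R).det * x) := by
  have h0 : g.val 0 0 = 1 := by simpa [Matrix.mulVec, dotProduct] using congrFun hg 0
  have h1 : g.val 1 0 = 0 := by simpa [Matrix.mulVec, dotProduct] using congrFun hg 1
  ext i j
  fin_cases i <;> fin_cases j <;>
    (simp [Matrix.mul_apply, Matrix.det_fin_two, h0, h1]; try ring)

/-- An additive character turns integer combinations into ordered products of powers. -/
lemma AddChar.prod_ofFn_zpow {A G : Type*} [AddCommGroup A] [Group G] (ψ : AddChar A G) {k : ℕ}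
    (x : Fin k → A) (n : Fin k → ℤ) :
    (List.ofFn fun i => ψ (x i) ^ n i).prod = ψ (∑ i, n i • x i) := by
  induction k with
  | zero => simp
  | succ k ih =>
    rw [List.ofFn_succ, List.prod_cons, ih, Fin.sum_univ_succ, AddChar.map_add_eq_mul,
      AddChar.map_zsmul_eq_zpow]

/-- Let `ξ : Γ → GL₂(ℝ)` fix `e₁` and set `ρ := det ∘ ξ`. Let `a ∈ Γ`, `k ≥ 1` and
`b₁, …, b_k ∈ [Γ,Γ]` with `ξ(b_{i₀}) ≠ 1` for some `i₀`, and suppose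
`a⁻¹ bᵢ a = ∏_ℓ b_ℓ^{n_{iℓ}}` (ordered product) for integers `n_{iℓ}`. Then `ρ(a)` is an
eigenvalue of the real matrix `N = (n_{iℓ})`: indeed `ξ(bᵢ) = [[1, xᵢ],[0,1]]` for some
`xᵢ ∈ ℝ`, the vector `x = (x₁,…,x_k)` is nonzero, and `N·x = ρ(a)·x`. -/
theorem stmt8 (Γ : Type*) [Group Γ] (ξ : Γ →* GL (Fin 2) ℝ)
    (hfix : ∀ γ : Γ, (ξ γ : Matrix (Fin 2) (Fin 2) ℝ).mulVec ![1, 0] = ![1, 0])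
    (k : ℕ) (hk : 1 ≤ k) (a : Γ) (b : Fin k → Γ)
    (hbcomm : ∀ i : Fin k, b i ∈ commutator Γ)
    (hbnt : ∃ i₀ : Fin k, ξ (b i₀) ≠ 1)
    (n : Fin k → Fin k → ℤ)
    (hconj : ∀ i : Fin k, a⁻¹ * b i * a = (List.ofFn fun ℓ : Fin k => b ℓ ^ n i ℓ).prod) :
    ∃ x : Fin k → ℝ, x ≠ 0 ∧
      (∀ i : Fin k, (ξ (b i) : Matrix (Fin 2) (Fin 2) ℝ) = !![1, x i; 0, 1]) ∧
      (Matrix.of fun i ℓ : Fin k => (n i ℓ : ℝ)).mulVec x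
        = (ξ a : Matrix (Fin 2) (Fin 2) ℝ).det • x := by
  have hdet (i) : (ξ (b i) : Matrix (Fin 2) (Fin 2) ℝ).det = 1 := by
    have h := Abelianization.commutator_subset_ker (Matrix.GeneralLinearGroup.det.comp ξ)
      (hbcomm i)
    simpa using congrArg Units.val (MonoidHom.mem_ker.mp h)
  have hb (i) := eq_upperRightHom_of_mulVec_of_det (ξ (b i)) (hfix _) (hdet i)
  refine ⟨fun i => (ξ (b i)).val 0 1, fun hx => ?_, fun i => ?_, funext fun i => ?_⟩
  · obtain ⟨i, hi⟩ := hbnt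
    have hxi : (ξ (b i)).val 0 1 = 0 := congrFun hx i
    exact hi (by rw [hb i, hxi, AddChar.map_zero_eq_one])
  · conv_lhs => rw [hb i]
    simp
  · have h := congrArg ξ (hconj i)
    rw [mul_assoc, map_mul, map_inv, inv_mul_eq_iff_eq_mul, map_mul, map_list_prod,
      List.map_ofFn] at h
    have hp : (List.ofFn (ξ ∘ fun l => b l ^ n i l)).prod =
        Matrix.GeneralLinearGroup.upperRightHom (∑ l, n i l • (ξ (b l)).val 0 1) := by
      rw [← AddChar.prod_ofFn_zpow]
      congr 2
      funext l
      rw [Function.comp_apply, map_zpow, ← hb l]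
    rw [hp, hb i, upperRightHom_mul_eq_mul_upperRightHom _ (hfix a), mul_right_inj] at h
    simpa [Matrix.mulVec, dotProduct] using (Matrix.GeneralLinearGroup.injective_upperRightHom h).symm
end

section
/- Let Γ be a group and ξ : Γ → GL₂(ℝ) a group homomorphism. Suppose a, b₀ ∈ Γ are such that ξ(a) = [[1, 0], [0, r]] with r ≠ 1 (and r ≠ 0), and ξ(b₀) = [[1, l], [0, s]] with l ≠ 0 (and s ≠ 0). Define recursively b_{i+1} := b_i^{-1} a^{-1} b_i a for i ≥ 0. Then for every i ≥ 1 one has ξ(b_i) = [[1, l·(r − 1)^i], [0, 1]]; in particular ξ(b_i) ≠ 1 and hence b_i ≠ 1 for every i ≥ 0. -/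
/-- The commutator of an upper triangular matrix `!![1, x; 0, s]` with the diagonal matrix
`!![1, 0; 0, r]` is unipotent. -/
theorem GL_commutator_eq_unipotent {K : Type*} [Field K] {A B : GL (Fin 2) K} {r x s : K}
    (hr : r ≠ 0) (hs : s ≠ 0) (hA : (A : Matrix (Fin 2) (Fin 2) K) = !![1, 0; 0, r])
    (hB : (B : Matrix (Fin 2) (Fin 2) K) = !![1, x; 0, s]) :
    ((B⁻¹ * A⁻¹ * B * A : GL (Fin 2) K) : Matrix (Fin 2) (Fin 2) K) =
      !![1, x * (r - 1); 0, 1] := by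
  have hmul : !![1, x; 0, s]⁻¹ * !![1, 0; 0, r]⁻¹ * !![1, x; 0, s] * !![1, 0; 0, r] =
      !![1, x * (r - 1); 0, 1] := by
    simp only [Matrix.inv_def, Matrix.det_fin_two_of, Matrix.adjugate_fin_two_of]
    ext i j
    fin_cases i <;> fin_cases j <;> simp [hr, hs] <;> field_simp
    ring
  simpa only [Units.val_mul, Matrix.coe_units_inv, hA, hB] using hmul

/-- Let `ξ : Γ → GL₂(ℝ)` with `ξ(a) = [[1,0],[0,r]]`, `r ≠ 1`, `r ≠ 0`, and
`ξ(b₀) = [[1,l],[0,s]]`, `l ≠ 0`, `s ≠ 0`. Define `b_{i+1} := b_i⁻¹ a⁻¹ b_i a`. Then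
`ξ(b_i) = [[1, l(r-1)^i],[0,1]]` for every `i ≥ 1`; in particular `ξ(b_i) ≠ 1` and
`b_i ≠ 1` for every `i ≥ 0`. -/
theorem stmt13 (Γ : Type*) [Group Γ] (ξ : Γ →* GL (Fin 2) ℝ)
    (a b₀ : Γ) (r l s : ℝ) (hr1 : r ≠ 1) (hr0 : r ≠ 0) (hl : l ≠ 0) (hs : s ≠ 0)
    (hξa : (ξ a : Matrix (Fin 2) (Fin 2) ℝ) = !![1, 0; 0, r])
    (hξb : (ξ b₀ : Matrix (Fin 2) (Fin 2) ℝ) = !![1, l; 0, s])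
    (b : ℕ → Γ) (hb0 : b 0 = b₀)
    (hrec : ∀ i : ℕ, b (i + 1) = (b i)⁻¹ * a⁻¹ * b i * a) :
    (∀ i : ℕ, 1 ≤ i → (ξ (b i) : Matrix (Fin 2) (Fin 2) ℝ) = !![1, l * (r - 1) ^ i; 0, 1]) ∧
    (∀ i : ℕ, ξ (b i) ≠ 1) ∧ (∀ i : ℕ, b i ≠ 1) := by
  have hstep : ∀ (i : ℕ) (x t : ℝ), t ≠ 0 →
      (ξ (b i) : Matrix (Fin 2) (Fin 2) ℝ) = !![1, x; 0, t] →
      (ξ (b (i + 1)) : Matrix (Fin 2) (Fin 2) ℝ) = !![1, x * (r - 1); 0, 1] := by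
    intro i x t ht hi
    rw [hrec, map_mul, map_mul, map_mul, map_inv, map_inv]
    exact GL_commutator_eq_unipotent hr0 ht hξa hi
  have hform : ∀ i : ℕ, 1 ≤ i →
      (ξ (b i) : Matrix (Fin 2) (Fin 2) ℝ) = !![1, l * (r - 1) ^ i; 0, 1] := by
    intro i hi
    induction i, hi using Nat.le_induction with
    | base => simpa using hstep 0 l s hs (hb0 ▸ hξb)
    | succ i _ ih => simpa [pow_succ, mul_assoc] using hstep i _ 1 one_ne_zero ih
  have hne : ∀ i : ℕ, ξ (b i) ≠ 1 := by
    intro i h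
    have hcorner : (ξ (b i) : Matrix (Fin 2) (Fin 2) ℝ) 0 1 = 0 := by simp [h]
    rcases Nat.eq_zero_or_pos i with rfl | hi
    · exact hl (by simpa [hb0, hξb] using hcorner)
    · rw [hform i hi] at hcorner
      exact mul_ne_zero hl (pow_ne_zero i (sub_ne_zero.mpr hr1)) (by simpa using hcorner)
  exact ⟨hform, hne, fun i h => hne i (by rw [h, map_one])⟩
end
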